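/- Assume A is generated by the s's and 𝔇 is a masa in A, i.e. {X ∈ A : XD = DX for all D ∈ 𝔇} = 𝔇. Then {X ∈ A : λ(X) = X for every unital *-homomorphism λ : A → A for which there exist unitaries U, V ∈ 𝔇 with λ(s_{e_i}) = U s_{e_i} and λ(s_{f_j}) = V s_{f_j} for all i, j} = 𝔇. -/

import Mathlib

open scoped ComplexOrder

noncomputable section

variable {A : Type*} [CStarAlgebra A]

/-- The map `λ_ε` associated to a family `s`: `X ↦ ∑ i, s i * X * (s i)^*`.
With `s = s_e` this is `λ_{ε₁}`; with `s = s_f` this is `λ_{ε₂}`. -/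
def lamE {m : ℕ} (s : Fin m → A) (X : A) : A := ∑ i, s i * X * star (s i)

/-- The word `s_{a,b} = s_{e_{a_1}}⋯s_{e_{a_k}} s_{f_{b_1}}⋯s_{f_{b_l}}` of degree `(k,l)`. -/
def sWord {m n : ℕ} (se : Fin m → A) (sf : Fin n → A)
    {k l : ℕ} (a : Fin k → Fin m) (b : Fin l → Fin n) : A :=
  (List.ofFn fun t => se (a t)).prod * (List.ofFn fun t => sf (b t)).prod

/-- The UHF core `𝔉`: closed linear span of `s_{a,b} s_{a',b'}^*` over pairs of words of
equal degree. -/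
def FF {m n : ℕ} (se : Fin m → A) (sf : Fin n → A) : Submodule ℂ A :=
  (Submodule.span ℂ {x : A | ∃ (k l : ℕ) (a a' : Fin k → Fin m) (b b' : Fin l → Fin n),
    x = sWord se sf a b * star (sWord se sf a' b')}).topologicalClosure

/-- The canonical masa `𝔇`: closed linear span of `s_{a,b} s_{a,b}^*`. -/
def DD {m n : ℕ} (se : Fin m → A) (sf : Fin n → A) : Submodule ℂ A :=
  (Submodule.span ℂ {x : A | ∃ (k l : ℕ) (a : Fin k → Fin m) (b : Fin l → Fin n),
    x = sWord se sf a b * star (sWord se sf a b)}).topologicalClosure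

/-- Continuous linear maps that agree on the projections `s_{a,b} s_{a,b}^*` agree on `𝔇`. -/
theorem eq_on_DD {m n : ℕ} {se : Fin m → A} {sf : Fin n → A} (f g : A →ₗ[ℂ] A)
    (hf : Continuous f) (hg : Continuous g)
    (h : ∀ (k l : ℕ) (a : Fin k → Fin m) (b : Fin l → Fin n),
      f (sWord se sf a b * star (sWord se sf a b)) = g (sWord se sf a b * star (sWord se sf a b)))
    {d : A} (hd : d ∈ DD se sf) : f d = g d := by
  have hle : DD se sf ≤ LinearMap.eqLocus f g := by
    refine Submodule.topologicalClosure_minimal _ ?_ (isClosed_eq hf hg)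
    rw [Submodule.span_le]
    rintro x ⟨k, l, a, b, rfl⟩
    exact h k l a b
  exact hle hd

theorem sWord_mul_star_mem_DD {m n : ℕ} (se : Fin m → A) (sf : Fin n → A)
    {k l : ℕ} (a : Fin k → Fin m) (b : Fin l → Fin n) :
    sWord se sf a b * star (sWord se sf a b) ∈ DD se sf :=
  Submodule.le_topologicalClosure _ (Submodule.subset_span ⟨k, l, a, b, rfl⟩)

theorem one_mem_DD {m n : ℕ} (se : Fin m → A) (sf : Fin n → A) : (1 : A) ∈ DD se sf := by
  simpa [sWord] using sWord_mul_star_mem_DD se sf (k := 0) (l := 0) Fin.elim0 Fin.elim0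

theorem sWord_cons_left {m n : ℕ} (se : Fin m → A) (sf : Fin n → A)
    {k l : ℕ} (i : Fin m) (a : Fin k → Fin m) (b : Fin l → Fin n) :
    sWord se sf (Fin.cons i a : Fin (k + 1) → Fin m) b = se i * sWord se sf a b := by
  simp [sWord, List.ofFn_succ, mul_assoc]

theorem sWord_cons_right {m n : ℕ} (se : Fin m → A) (sf : Fin n → A)
    {l : ℕ} (a : Fin 0 → Fin m) (j : Fin n) (b : Fin l → Fin n) :
    sWord se sf a (Fin.cons j b : Fin (l + 1) → Fin n) = sf j * sWord se sf a b := by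
  simp [sWord, List.ofFn_succ]

/-- An `f`-edge can be moved past an `e`-word. -/
theorem exists_sf_mul_prod_se {m n : ℕ} {θ : Equiv.Perm (Fin m × Fin n)}
    {se : Fin m → A} {sf : Fin n → A}
    (hcomm : ∀ i j, se i * sf j = sf (θ (i, j)).2 * se (θ (i, j)).1)
    {k : ℕ} (j : Fin n) (a : Fin k → Fin m) :
    ∃ (a' : Fin k → Fin m) (j' : Fin n),
      sf j * (List.ofFn fun t => se (a t)).prod = (List.ofFn fun t => se (a' t)).prod * sf j' := by
  induction k generalizing j with
  | zero => exact ⟨a, j, by simp⟩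
  | succ k ih =>
    have hswap := hcomm (θ.symm (a 0, j)).1 (θ.symm (a 0, j)).2
    simp only [Prod.mk.eta, Equiv.apply_symm_apply] at hswap
    obtain ⟨a', j', h⟩ := ih (θ.symm (a 0, j)).2 (fun t => a t.succ)
    refine ⟨Fin.cons (θ.symm (a 0, j)).1 a', j', ?_⟩
    simp only [List.ofFn_succ, List.prod_cons, Fin.cons_zero, Fin.cons_succ]
    rw [← mul_assoc, ← hswap, mul_assoc, h, mul_assoc]

theorem exists_sWord_eq_sf_mul {m n : ℕ} {θ : Equiv.Perm (Fin m × Fin n)}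
    {se : Fin m → A} {sf : Fin n → A}
    (hcomm : ∀ i j, se i * sf j = sf (θ (i, j)).2 * se (θ (i, j)).1)
    {k l : ℕ} (j : Fin n) (a : Fin k → Fin m) (b : Fin l → Fin n) :
    ∃ (a' : Fin k → Fin m) (b' : Fin (l + 1) → Fin n),
      sWord se sf a' b' = sf j * sWord se sf a b := by
  obtain ⟨a', j', h⟩ := exists_sf_mul_prod_se hcomm j a
  refine ⟨a', Fin.cons j' b, ?_⟩
  simp only [sWord, List.ofFn_succ, List.prod_cons, Fin.cons_zero, Fin.cons_succ]
  rw [← mul_assoc, ← mul_assoc, h]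

theorem lamE_mul_self {m : ℕ} {s : Fin m → A}
    (hs : ∀ i k, star (s i) * s k = if i = k then (1 : A) else 0) (X : A) (k : Fin m) :
    lamE s X * s k = s k * X := by
  simp [lamE, Finset.sum_mul, mul_assoc, hs]

theorem lamE_mul {m : ℕ} {s : Fin m → A}
    (hs : ∀ i k, star (s i) * s k = if i = k then (1 : A) else 0) (X Y : A) :
    lamE s (X * Y) = lamE s X * lamE s Y := by
  conv_rhs => rw [lamE.eq_def s Y, Finset.mul_sum]
  refine Finset.sum_congr rfl fun i _ => ?_
  simp only [← mul_assoc, lamE_mul_self hs]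

theorem star_lamE {m : ℕ} (s : Fin m → A) (X : A) : star (lamE s X) = lamE s (star X) := by
  simp [lamE, star_sum, mul_assoc]

theorem lamE_mem_unitary {m : ℕ} {s : Fin m → A}
    (hs : ∀ i k, star (s i) * s k = if i = k then (1 : A) else 0)
    (hs1 : ∑ i, s i * star (s i) = 1) {W : A} (hW : W ∈ unitary A) :
    lamE s W ∈ unitary A := by
  have h1 : lamE s (1 : A) = 1 := by simpa [lamE] using hs1
  rw [Unitary.mem_iff] at hW ⊢
  rw [star_lamE, ← lamE_mul hs, ← lamE_mul hs, hW.1, hW.2]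
  exact ⟨h1, h1⟩

theorem lamE_one_sub_two_smul_mem {m : ℕ} {s : Fin m → A} (hs1 : ∑ i, s i * star (s i) = 1)
    {D : Submodule ℂ A} (h1 : (1 : A) ∈ D) {p : A} (hp : ∀ i, s i * p * star (s i) ∈ D) :
    lamE s (1 - (2 : ℂ) • p) ∈ D := by
  have h : lamE s (1 - (2 : ℂ) • p) = 1 - (2 : ℂ) • ∑ i, s i * p * star (s i) := by
    simp [lamE, mul_sub, sub_mul, Finset.sum_sub_distrib, hs1, Finset.smul_sum]
  rw [h]
  exact D.sub_mem h1 (D.smul_mem _ (D.sum_mem fun i _ => hp i))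

theorem star_sWord_mul_self {m n : ℕ} {se : Fin m → A} {sf : Fin n → A}
    (he : ∀ i, star (se i) * se i = 1) (hf : ∀ j, star (sf j) * sf j = 1)
    {k l : ℕ} (a : Fin k → Fin m) (b : Fin l → Fin n) :
    star (sWord se sf a b) * sWord se sf a b = 1 := by
  induction k with
  | zero =>
    induction l with
    | zero => simp [sWord]
    | succ l ih =>
      rw [← Fin.cons_self_tail b, sWord_cons_right, star_mul, mul_assoc, ← mul_assoc (star (sf _)),
        hf, one_mul, ih]
  | succ k ih =>
    rw [← Fin.cons_self_tail a, sWord_cons_left, star_mul, mul_assoc, ← mul_assoc (star (se _)),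
      he, one_mul, ih]

theorem map_sWord_mul_star {m n : ℕ} {se : Fin m → A} {sf : Fin n → A}
    (hDD : ∀ x ∈ DD se sf, ∀ d ∈ DD se sf, x * d = d * x)
    (lam : A →⋆ₐ[ℂ] A) {U V : A} (hU : U ∈ unitary A) (hV : V ∈ unitary A)
    (hUD : U ∈ DD se sf) (hVD : V ∈ DD se sf)
    (hle : ∀ i, lam (se i) = U * se i) (hlf : ∀ j, lam (sf j) = V * sf j)
    {k l : ℕ} (a : Fin k → Fin m) (b : Fin l → Fin n) :
    lam (sWord se sf a b * star (sWord se sf a b)) =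
      sWord se sf a b * star (sWord se sf a b) := by
  have key : ∀ (x y Z : A), Z ∈ unitary A → Z ∈ DD se sf →
      x * y * star (x * y) ∈ DD se sf → lam x = Z * x → lam (y * star y) = y * star y →
      lam (x * y * star (x * y)) = x * y * star (x * y) := by
    intro x y Z hZ hZD hxy hx hy
    calc lam (x * y * star (x * y)) = lam x * lam (y * star y) * star (lam x) := by
          simp only [map_mul, map_star, star_mul, mul_assoc]
      _ = Z * (x * y * star (x * y)) * star Z := by
          rw [hy, hx]; simp only [star_mul, mul_assoc]
      _ = x * y * star (x * y) := by
          rw [hDD Z hZD _ hxy, mul_assoc, Unitary.mul_star_self_of_mem hZ, mul_one]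
  induction k with
  | zero =>
    induction l with
    | zero => simp [sWord]
    | succ l ih =>
      have hmem := sWord_mul_star_mem_DD se sf a b
      rw [← Fin.cons_self_tail b, sWord_cons_right] at hmem ⊢
      exact key _ _ V hV hVD hmem (hlf _) (ih _)
  | succ k ih =>
    have hmem := sWord_mul_star_mem_DD se sf a b
    rw [← Fin.cons_self_tail a, sWord_cons_left] at hmem ⊢
    exact key _ _ U hU hUD hmem (hle _) (ih _)

/-- Proposition 4.3(i): the fixed point set of the family of
endomorphisms `λ_{(U,V)}` with `U, V ∈ 𝒰(𝔇)` is exactly `𝔇`. -/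
theorem stmt11 {m n : ℕ} (hm : 1 ≤ m) (hn : 1 ≤ n) (θ : Equiv.Perm (Fin m × Fin n))
    (se : Fin m → A) (sf : Fin n → A)
    (he : ∀ i k, star (se i) * se k = if i = k then (1:A) else 0)
    (hf : ∀ j l, star (sf j) * sf l = if j = l then (1:A) else 0)
    (hcomm : ∀ i j, se i * sf j = sf (θ (i, j)).2 * se (θ (i, j)).1)
    (hde : ∑ i, se i * star (se i) = 1)
    (hdf : ∑ j, sf j * star (sf j) = 1)
    (hgen : (StarAlgebra.adjoin ℂ (Set.range se ∪ Set.range sf)).topologicalClosure = ⊤)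
    (hmasa : {X : A | ∀ d ∈ DD se sf, X * d = d * X} = (DD se sf : Set A)) :
    {X : A | ∀ lam : A →⋆ₐ[ℂ] A,
        (∃ U V : A, U ∈ unitary A ∧ V ∈ unitary A ∧ U ∈ DD se sf ∧ V ∈ DD se sf ∧
          (∀ i, lam (se i) = U * se i) ∧ (∀ j, lam (sf j) = V * sf j)) →
        lam X = X} = (DD se sf : Set A) := by
  have hDD : ∀ x ∈ DD se sf, ∀ d ∈ DD se sf, x * d = d * x := fun x hx =>
    (Set.ext_iff.mp hmasa x).mpr hx
  have hmul : ∀ x ∈ DD se sf, ∀ y ∈ DD se sf, x * y ∈ DD se sf := by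
    intro x hx y hy
    refine (Set.ext_iff.mp hmasa (x * y)).mp fun d hd => ?_
    rw [mul_assoc, hDD y hy d hd, ← mul_assoc, hDD x hx d hd, mul_assoc]
  ext X
  constructor
  · intro hX
    refine (Set.ext_iff.mp hmasa X).mp fun d hd => ?_
    refine eq_on_DD (LinearMap.mulLeft ℂ X) (LinearMap.mulRight ℂ X) (continuous_const_mul X)
      (continuous_mul_const X) (fun k l a b => ?_) hd
    set p := sWord se sf a b * star (sWord se sf a b) with hp
    have hpstar : star p = p := by simp [hp]
    have hpp : p * p = p := by
      rw [hp, mul_assoc, ← mul_assoc (star _),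
        star_sWord_mul_self (by simp [he]) (by simp [hf]), one_mul]
    set W : A := 1 - (2 : ℂ) • p with hW
    have hWstar : star W = W := by simp [hW, hpstar]
    have hWW : W * W = 1 := by
      simp only [hW, mul_sub, sub_mul, one_mul, mul_one, smul_mul_assoc, mul_smul_comm, hpp]
      module
    have hWu : W ∈ unitary A := by
      rw [Unitary.mem_iff, hWstar]
      exact ⟨hWW, hWW⟩
    have hWD : W ∈ DD se sf :=
      (DD se sf).sub_mem (one_mem_DD se sf)
        ((DD se sf).smul_mem _ (sWord_mul_star_mem_DD se sf a b))
    have hE : lamE se W ∈ DD se sf := by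
      refine lamE_one_sub_two_smul_mem hde (one_mem_DD se sf) fun i => ?_
      have := sWord_mul_star_mem_DD se sf (Fin.cons i a : Fin (k + 1) → Fin m) b
      rw [sWord_cons_left] at this
      simpa only [hp, star_mul, mul_assoc] using this
    have hF : lamE sf W ∈ DD se sf := by
      refine lamE_one_sub_two_smul_mem hdf (one_mem_DD se sf) fun j => ?_
      obtain ⟨a', b', h⟩ := exists_sWord_eq_sf_mul hcomm j a b
      have := sWord_mul_star_mem_DD se sf a' b'
      rw [h] at this
      simpa only [hp, star_mul, mul_assoc] using this
    have hfix := hX (Unitary.conjStarAlgAut ℂ A ⟨W, hWu⟩ : A →⋆ₐ[ℂ] A)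
      ⟨W * lamE se W, W * lamE sf W, mul_mem hWu (lamE_mem_unitary he hde hWu),
        mul_mem hWu (lamE_mem_unitary hf hdf hWu), hmul _ hWD _ hE, hmul _ hWD _ hF,
        fun i => by simp [Unitary.conjStarAlgAut_apply, hWstar, mul_assoc, lamE_mul_self he],
        fun j => by simp [Unitary.conjStarAlgAut_apply, hWstar, mul_assoc, lamE_mul_self hf]⟩
    have hWXW : W * X * W = X := by
      simpa [Unitary.conjStarAlgAut_apply, hWstar] using hfix
    have hWX : W * X = X * W := by
      conv_rhs => rw [← hWXW, mul_assoc, hWW, mul_one]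
    simp only [hW, sub_mul, mul_sub, one_mul, mul_one, smul_mul_assoc, mul_smul_comm,
      sub_right_inj] at hWX
    exact (smul_right_injective A (two_ne_zero' ℂ) hWX).symm
  · rintro hX lam ⟨U, V, hU, hV, hUD, hVD, hle, hlf⟩
    exact eq_on_DD (lam : A →ₗ[ℂ] A) LinearMap.id (AddMonoidHomClass.continuous_of_bound lam 1
        fun x => by simpa using NonUnitalStarAlgHom.norm_apply_le lam x) continuous_id
      (fun k l a b => map_sWord_mul_star hDD lam hU hV hUD hVD hle hlf a b) hX
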